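/- There do not exist real numbers a₁₁, a₂₂, a₁₂, b₁, b₂ with (a₁₁ − 1)(a₂₂ − 1) > a₁₂², a₁₁ − 1 > 0, a₂₂ − 1 > 0 that simultaneously satisfy b₂a₁₂ − b₁(a₂₂ − 1) > 0, b₂a₁₂ − b₁(a₂₂ + 1) ≤ 0, b₁a₁₂ − b₂(a₁₁ − 1) ≤ 0, and b₁a₁₂ − b₂(a₁₁ + 1) > 0. -/

import Mathlib

/-- There do not exist real numbers `a₁₁, a₂₂, a₁₂, b₁, b₂` with `A - I` positive definite
(expressed by `(a₁₁ - 1)(a₂₂ - 1) > a₁₂²`, `a₁₁ - 1 > 0`, `a₂₂ - 1 > 0`) satisfying the four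
sign conditions simultaneously. -/
theorem stmt_10 :
    ¬ ∃ a11 a22 a12 b1 b2 : ℝ,
      (a11 - 1) * (a22 - 1) > a12 ^ 2 ∧ a11 - 1 > 0 ∧ a22 - 1 > 0 ∧
      b2 * a12 - b1 * (a22 - 1) > 0 ∧
      b2 * a12 - b1 * (a22 + 1) ≤ 0 ∧
      b1 * a12 - b2 * (a11 - 1) ≤ 0 ∧
      b1 * a12 - b2 * (a11 + 1) > 0 := by
  rintro ⟨a11, a22, a12, b1, b2, h, hp, hq, h1, h2, h3, h4⟩
  have hb1 : 0 < b1 := by nlinarith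
  have hb2 : b2 < 0 := by nlinarith
  have hc : a12 < 0 := by
    by_contra hc
    push Not at hc
    have e1 := mul_pos hb1 hq
    have e2 := mul_nonneg hc (neg_pos.mpr hb2).le
    linarith
  have e1 := mul_pos h1 hp
  have e2 := mul_nonneg_of_nonpos_of_nonpos h3 hc.le
  have e3 := mul_pos hb1 (sub_pos.mpr h)
  nlinarith
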